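/- An entire function f satisfies f(z)⁴ − (f'(z))⁴ = (1/2)e^{2iz} + (1/2)e^{−2iz} for all z ∈ ℂ if and only if there exists a complex constant c with c⁴ = 1 and f(z) = c·cos z for all z, or there exists a complex constant c with c⁴ = −1 and f(z) = c·sin z for all z. Equivalently, the only entire solutions are the eight functions f_j(z) = e^{2jπi/4}cos z and g_k(z) = e^{(2k+1)πi/4}sin z for j, k ∈ {0, 1, 2, 3}. -/

import Mathlib

open Complex

/-- Entire solutions of `f ^ 4 - (deriv f) ^ 4 = cos (2 z)`. -/
structure IsFermatSolution (f : ℂ → ℂ) : Prop where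
  differentiable : Differentiable ℂ f
  eq : ∀ z, f z ^ 4 - deriv f z ^ 4 = cos (2 * z)

lemma norm_exp_two_mul_I_mul (z : ℂ) : ‖exp (2 * z * I)‖ = Real.exp (-(2 * z.im)) := by
  rw [norm_exp]; simp

lemma norm_exp_neg_two_mul_I_mul (z : ℂ) : ‖exp (-(2 * z) * I)‖ = Real.exp (2 * z.im) := by
  rw [norm_exp]; simp

lemma norm_cos_two_mul_le {z : ℂ} {y : ℝ} (hz : |z.im| ≤ y) :
    ‖cos (2 * z)‖ ≤ Real.exp (2 * y) := by
  have h1 : Real.exp (-(2 * z.im)) ≤ Real.exp (2 * y) :=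
    Real.exp_le_exp.2 (by linarith [neg_abs_le z.im])
  have h2 : Real.exp (2 * z.im) ≤ Real.exp (2 * y) :=
    Real.exp_le_exp.2 (by linarith [le_abs_self z.im])
  rw [Complex.cos, norm_div, Complex.norm_two, div_le_iff₀ two_pos]
  refine (norm_add_le _ _).trans ?_
  rw [norm_exp_two_mul_I_mul, norm_exp_neg_two_mul_I_mul]
  linarith

lemma exp_neg_le_exp_div_two {y : ℝ} (hy : 1 ≤ y) :
    Real.exp (-(2 * y)) ≤ Real.exp (2 * y) / 2 := by
  have h1 : Real.exp (2 * y) = Real.exp (-(2 * y)) * Real.exp (4 * y) := by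
    rw [← Real.exp_add]; ring_nf
  have h2 := Real.add_one_le_exp (4 * y)
  have h3 := Real.exp_pos (-(2 * y))
  nlinarith

lemma exp_div_four_le_norm_cos {z : ℂ} (hz : 1 ≤ z.im) :
    Real.exp (2 * z.im) / 4 ≤ ‖cos (2 * z)‖ := by
  have h := exp_neg_le_exp_div_two hz
  rw [Complex.cos, norm_div, Complex.norm_two, le_div_iff₀ two_pos]
  have := norm_sub_le_norm_add (exp (-(2 * z) * I)) (exp (2 * z * I))
  rw [norm_exp_two_mul_I_mul, norm_exp_neg_two_mul_I_mul, add_comm] at this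
  linarith

lemma exp_div_four_le_norm_sin {z : ℂ} (hz : 1 ≤ z.im) :
    Real.exp (2 * z.im) / 4 ≤ ‖sin (2 * z)‖ := by
  have h := exp_neg_le_exp_div_two hz
  rw [Complex.sin, norm_div, norm_mul, norm_I, Complex.norm_two, le_div_iff₀ two_pos]
  have := norm_sub_norm_le (exp (-(2 * z) * I)) (exp (2 * z * I))
  rw [norm_exp_two_mul_I_mul, norm_exp_neg_two_mul_I_mul] at this
  linarith

lemma cos_two_mul_ne_zero {z : ℂ} (hz : 1 ≤ z.im) : cos (2 * z) ≠ 0 :=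
  norm_pos_iff.1 (lt_of_lt_of_le (by positivity) (exp_div_four_le_norm_cos hz))

/-- A quarter of the logarithmic derivative of `cos (2 z)` tends to `-I / 2`. -/
lemma norm_tan_add_le {z : ℂ} (hz : 1 ≤ z.im) :
    ‖-(sin (2 * z) / (2 * cos (2 * z))) + I / 2‖ ≤ 2 * Real.exp (-(4 * z.im)) := by
  have hc := cos_two_mul_ne_zero hz
  have h1 : -(sin (2 * z) / (2 * cos (2 * z))) + I / 2 =
      I * exp (2 * z * I) / (2 * cos (2 * z)) := by
    rw [exp_mul_I]
    field_simp
    linear_combination (-sin (2 * z)) * I_sq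
  rw [h1, norm_div, norm_mul, norm_mul, norm_I, Complex.norm_two, norm_exp_two_mul_I_mul,
    div_le_iff₀ (by positivity)]
  have h2 : Real.exp (-(2 * z.im)) = Real.exp (-(4 * z.im)) * Real.exp (2 * z.im) := by
    rw [← Real.exp_add]; ring_nf
  have h3 := mul_le_mul_of_nonneg_left (exp_div_four_le_norm_cos hz)
    (Real.exp_pos (-(4 * z.im))).le
  linarith

namespace IsFermatSolution

variable {f : ℂ → ℂ}

lemma differentiable_deriv (hf : IsFermatSolution f) : Differentiable ℂ (deriv f) := by
  have := hf.differentiable.differentiableOn.deriv isOpen_univ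
  exact differentiableOn_univ.1 this

lemma hasDerivAt (hf : IsFermatSolution f) (z : ℂ) : HasDerivAt f (deriv f z) z :=
  (hf.differentiable z).hasDerivAt

lemma hasDerivAt_deriv (hf : IsFermatSolution f) (z : ℂ) :
    HasDerivAt (deriv f) (deriv (deriv f) z) z :=
  (hf.differentiable_deriv z).hasDerivAt

lemma deriv_eq (hf : IsFermatSolution f) (z : ℂ) :
    2 * f z ^ 3 * deriv f z - 2 * deriv f z ^ 3 * deriv (deriv f) z = -sin (2 * z) := by
  have h1 := ((hf.hasDerivAt z).pow 4).sub ((hf.hasDerivAt_deriv z).pow 4)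
  have h2 : HasDerivAt (fun z => cos (2 * z)) (-sin (2 * z) * (2 * 1)) z :=
    ((hasDerivAt_id z).const_mul 2).ccos
  have h3 : (f ^ 4 - deriv f ^ 4 : ℂ → ℂ) = fun z => cos (2 * z) := funext hf.eq
  rw [h3] at h1
  have := h1.unique h2
  push_cast at this
  linear_combination this / 2

lemma comp_neg (hf : IsFermatSolution f) : IsFermatSolution (fun z => f (-z)) where
  differentiable := hf.differentiable.comp differentiable_neg
  eq z := by
    have h := hf.eq (-z)
    rw [mul_neg, cos_neg] at h
    rw [deriv_comp_neg, ← h]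
    ring

lemma norm_deriv_le (hf : IsFermatSolution f) {z : ℂ} {κ : ℝ} (hκ : 0 ≤ κ)
    (h : ‖cos (2 * z)‖ ≤ κ ^ 4) : ‖deriv f z‖ ≤ ‖f z‖ + κ := by
  have h1 : deriv f z ^ 4 = f z ^ 4 - cos (2 * z) := by linear_combination -hf.eq z
  have h2 : ‖deriv f z‖ ^ 4 ≤ ‖f z‖ ^ 4 + κ ^ 4 := by
    rw [← norm_pow, h1]
    refine (norm_sub_le _ _).trans ?_
    rw [norm_pow]; linarith
  refine le_of_pow_le_pow_left₀ (n := 4) (by norm_num) (by positivity) (h2.trans ?_)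
  exact pow_add_pow_le (norm_nonneg _) hκ (by norm_num)

lemma norm_add_le_mul_exp (hf : IsFermatSolution f) (z w : ℂ) {κ : ℝ} (hκ : 0 ≤ κ)
    (h : ∀ s ∈ Set.Icc (0 : ℝ) 1, ‖cos (2 * (z + s * w))‖ ≤ κ ^ 4) :
    ‖f (z + w)‖ ≤ (‖f z‖ + κ) * Real.exp ‖w‖ := by
  rcases eq_or_ne w 0 with rfl | hw
  · simpa using hκ
  have hd : ∀ s : ℝ, HasDerivAt (fun s : ℝ => f (z + s * w)) (deriv f (z + s * w) * w) s := by
    intro s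
    have h1 : HasDerivAt (fun s : ℝ => z + (s : ℂ) * w) w s := by
      simpa using (ofRealCLM.hasDerivAt.mul_const w).const_add z
    exact (hf.hasDerivAt _).comp s h1
  have key := norm_le_gronwallBound_of_norm_deriv_right_le (f := fun s : ℝ => f (z + s * w))
    (f' := fun s : ℝ => deriv f (z + s * w) * w) (δ := ‖f z‖) (K := ‖w‖) (ε := ‖w‖ * κ)
    (a := 0) (b := 1) (fun s _ => (hd s).continuousAt.continuousWithinAt)
    (fun s _ => (hd s).hasDerivWithinAt) (by simp)
    (fun s hs => by
      rw [norm_mul]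
      have := hf.norm_deriv_le hκ (h s ⟨hs.1, hs.2.le⟩)
      nlinarith [norm_nonneg w]) 1 (by simp)
  rw [gronwallBound_of_K_ne_0 (by simpa using hw)] at key
  have hw' : ‖w‖ ≠ 0 := by simpa using hw
  rw [mul_div_cancel_left₀ _ hw'] at key
  simp at key
  linarith

lemma norm_le_exp (hf : IsFermatSolution f) (z : ℂ) :
    ‖f z‖ ≤ (‖f 0‖ + 1) * Real.exp (2 * ‖z‖) := by
  have h := hf.norm_add_le_mul_exp 0 z (Real.exp_pos (‖z‖ / 2)).le (fun s hs => by
    rw [← Real.exp_nat_mul]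
    refine (norm_cos_two_mul_le (y := ‖z‖) ?_).trans (Real.exp_le_exp.2 (by push_cast; linarith))
    simp only [zero_add]
    refine (abs_im_le_norm _).trans ?_
    rw [norm_mul, norm_real, Real.norm_of_nonneg hs.1]
    nlinarith [norm_nonneg z, hs.2])
  rw [zero_add] at h
  refine h.trans ?_
  have h1 : Real.exp (2 * ‖z‖) = Real.exp ‖z‖ * Real.exp ‖z‖ := by rw [← Real.exp_add]; ring_nf
  have h2 : Real.exp (‖z‖ / 2) ≤ Real.exp ‖z‖ := Real.exp_le_exp.2 (by linarith [norm_nonneg z])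
  have h3 : 1 ≤ Real.exp ‖z‖ := Real.one_le_exp (norm_nonneg z)
  rw [h1, ← mul_assoc]
  gcongr
  nlinarith [norm_nonneg (f 0)]

lemma norm_deriv_le_exp (hf : IsFermatSolution f) (z : ℂ) :
    ‖deriv f z‖ ≤ (‖f 0‖ + 2) * Real.exp (2 * ‖z‖) := by
  have h := hf.norm_deriv_le (z := z) (Real.exp_pos (‖z‖ / 2)).le (by
    rw [← Real.exp_nat_mul]
    exact (norm_cos_two_mul_le (abs_im_le_norm z)).trans
      (Real.exp_le_exp.2 (by push_cast; linarith)))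
  have h2 : Real.exp (‖z‖ / 2) ≤ Real.exp (2 * ‖z‖) :=
    Real.exp_le_exp.2 (by linarith [norm_nonneg z])
  linarith [hf.norm_le_exp z]

lemma exp_half_le (hf : IsFermatSolution f) {z : ℂ} (hz : 1 ≤ z.im)
    (h : ‖deriv f z‖ ≤ ‖f z‖) : Real.exp (z.im / 2) ≤ 2 * ‖f z‖ := by
  refine le_of_pow_le_pow_left₀ (n := 4) (by norm_num) (by positivity) ?_
  rw [← Real.exp_nat_mul, mul_pow]
  have h1 := exp_div_four_le_norm_cos hz
  rw [← hf.eq z] at h1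
  have h2 := norm_sub_le (f z ^ 4) (deriv f z ^ 4)
  rw [norm_pow, norm_pow] at h2
  have h3 : ‖deriv f z‖ ^ 4 ≤ ‖f z‖ ^ 4 := by gcongr
  have h4 : ((4 : ℕ) : ℝ) * (z.im / 2) = 2 * z.im := by push_cast; ring
  rw [h4]
  have : 0 ≤ ‖f z‖ ^ 4 := by positivity
  linarith

lemma norm_deriv_deriv_le (hf : IsFermatSolution f) {z : ℂ} (hz : 1 ≤ z.im)
    (h : ‖deriv f z‖ ≤ ‖f z‖) : ‖deriv (deriv f) z‖ ≤ 19 * ‖f z‖ := by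
  have hκ : Real.exp ((z.im + 1) / 2) ≤ 4 * ‖f z‖ := by
    have h1 := hf.exp_half_le hz h
    have h2 : Real.exp ((z.im + 1) / 2) = Real.exp (z.im / 2) * Real.exp (1 / 2) := by
      rw [← Real.exp_add]; ring_nf
    have h3 : Real.exp (1 / 2) ≤ 2 := by
      refine le_of_pow_le_pow_left₀ (n := 2) (by norm_num) (by positivity) ?_
      rw [← Real.exp_nat_mul]
      norm_num
      linarith [Real.exp_one_lt_d9]
    rw [h2]
    nlinarith [Real.exp_pos (z.im / 2)]
  set κ := Real.exp ((z.im + 1) / 2) with hκdef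
  have hκ0 : 0 ≤ κ := (Real.exp_pos _).le
  have hcos : ∀ ζ : ℂ, ‖ζ - z‖ ≤ 1 → ‖cos (2 * ζ)‖ ≤ κ ^ 4 := by
    intro ζ hζ
    rw [hκdef, ← Real.exp_nat_mul]
    refine (norm_cos_two_mul_le (y := z.im + 1) ?_).trans
      (Real.exp_le_exp.2 (by push_cast; linarith))
    have := (abs_im_le_norm (ζ - z)).trans hζ
    rw [sub_im, abs_le] at this
    rw [abs_le]; constructor <;> linarith
  have key := norm_deriv_le_of_forall_mem_sphere_norm_le (c := z) (R := 1) (f := deriv f)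
    (C := 19 * ‖f z‖) one_pos hf.differentiable_deriv.diffContOnCl (fun ζ hζ => by
      have hζ' : ‖ζ - z‖ = 1 := by simpa [dist_eq_norm] using hζ
      have h1 := hf.norm_deriv_le hκ0 (hcos ζ hζ'.le)
      have h2 := hf.norm_add_le_mul_exp z (ζ - z) hκ0 (fun s hs => hcos _ (by
        rw [add_sub_cancel_left, norm_mul, hζ', mul_one, norm_real, Real.norm_of_nonneg hs.1]
        exact hs.2))
      rw [add_sub_cancel, hζ'] at h2
      have h3 : Real.exp 1 ≤ 3 := by linarith [Real.exp_one_lt_d9]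
      nlinarith [norm_nonneg (f z)])
  simpa using key

/-- In the upper half-plane `f / deriv f` is bounded. -/
lemma norm_le_mul_norm_deriv (hf : IsFermatSolution f) {z : ℂ} (hz : 1 ≤ z.im) :
    ‖f z‖ ≤ 161 * ‖deriv f z‖ := by
  rcases le_total ‖f z‖ ‖deriv f z‖ with h | h
  · linarith [norm_nonneg (deriv f z)]
  have hf0 : 0 < ‖f z‖ := by linarith [hf.exp_half_le hz h, Real.exp_pos (z.im / 2)]
  have h2 := hf.norm_deriv_deriv_le hz h
  have hs := exp_div_four_le_norm_sin hz
  have hc : ‖cos (2 * z)‖ ≤ 4 * ‖sin (2 * z)‖ := by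
    linarith [norm_cos_two_mul_le (abs_of_pos (by linarith : 0 < z.im)).le]
  have hs0 : 0 < ‖sin (2 * z)‖ := lt_of_lt_of_le (by positivity) hs
  set a := ‖f z‖
  set b := ‖deriv f z‖
  set s := ‖sin (2 * z)‖
  have hb0 : 0 ≤ b := norm_nonneg _
  have e : -(sin (2 * z)) * f z * f z ^ 3 = 2 * cos (2 * z) * deriv f z * f z ^ 3 +
      deriv f z ^ 3 * (-sin (2 * z) * deriv f z - 2 * cos (2 * z) * deriv (deriv f) z) := by
    rw [← hf.deriv_eq z, ← hf.eq z]; ring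
  have h3 : s * a * a ^ 3 ≤ 2 * (4 * s) * b * a ^ 3 +
      b ^ 3 * (s * b + 2 * (4 * s) * (19 * a)) := by
    have := congrArg norm e
    rw [norm_mul, norm_mul, norm_neg, norm_pow] at this
    rw [this]
    refine (norm_add_le _ _).trans (add_le_add ?_ ?_)
    · rw [norm_mul, norm_mul, norm_mul, norm_pow, Complex.norm_two]
      gcongr
    · rw [norm_mul, norm_pow]
      gcongr
      refine (norm_sub_le _ _).trans (add_le_add ?_ ?_)
      · rw [norm_mul, norm_neg]
      · rw [norm_mul, norm_mul, Complex.norm_two]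
        gcongr
  have h4 : b ^ 3 * (s * b + 2 * (4 * s) * (19 * a)) ≤ 153 * s * b * a ^ 3 := by
    calc b ^ 3 * (s * b + 2 * (4 * s) * (19 * a))
        ≤ b ^ 3 * (s * a + 2 * (4 * s) * (19 * a)) := by gcongr
      _ = 153 * s * b * (b ^ 2 * a) := by ring
      _ ≤ 153 * s * b * (a ^ 2 * a) := by gcongr
      _ = _ := by ring
  have h5 : (s * a ^ 3) * a ≤ (s * a ^ 3) * (161 * b) := by linarith
  exact le_of_mul_le_mul_left h5 (by positivity)

lemma deriv_ne_zero (hf : IsFermatSolution f) {z : ℂ} (hz : 1 ≤ z.im) : deriv f z ≠ 0 := by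
  intro h
  have h1 := hf.norm_le_mul_norm_deriv hz
  rw [h, norm_zero, mul_zero, norm_le_zero_iff] at h1
  have h2 := hf.eq z
  rw [h, h1] at h2
  exact cos_two_mul_ne_zero hz (by simpa using h2.symm)

end IsFermatSolution

lemma hasDerivAt_norm_sq_mul_exp {F : ℝ → ℂ} {φ : ℝ → ℝ} {a : ℂ} {b t : ℝ}
    (hF : HasDerivAt F (a * F t) t) (hφ : HasDerivAt φ b t) :
    HasDerivAt (fun t => ‖F t‖ ^ 2 * Real.exp (-(2 * φ t)))
      (2 * (a.re - b) * (‖F t‖ ^ 2 * Real.exp (-(2 * φ t)))) t := by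
  have h1 := hF.norm_sq.mul (hφ.const_mul 2).neg.exp
  refine h1.congr_deriv ?_
  have h2 : inner ℝ (F t) (a * F t) = a.re * ‖F t‖ ^ 2 := by
    rw [Complex.inner, mul_assoc, mul_conj, ← normSq_eq_norm_sq, re_mul_ofReal]
  rw [h2]
  simp only [Pi.neg_apply]
  ring

lemma sq_mul_exp_le_iff {x y p q : ℝ} (hx : 0 ≤ x) (hy : 0 ≤ y) :
    x ^ 2 * Real.exp (-(2 * p)) ≤ y ^ 2 * Real.exp (-(2 * q)) ↔ x ≤ y * Real.exp (p - q) := by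
  have h : y ^ 2 * Real.exp (-(2 * q)) = (y * Real.exp (p - q)) ^ 2 * Real.exp (-(2 * p)) := by
    rw [mul_pow, ← Real.exp_nat_mul, mul_assoc, ← Real.exp_add]
    push_cast
    ring_nf
  rw [h, mul_le_mul_iff_left₀ (Real.exp_pos _)]
  exact pow_le_pow_iff_left₀ hx (by positivity) two_ne_zero

lemma norm_le_mul_exp_of_re_le {F a : ℝ → ℂ} {φ b : ℝ → ℝ} {T : ℝ}
    (hF : ∀ t, T ≤ t → HasDerivAt F (a t * F t) t) (hφ : ∀ t, T ≤ t → HasDerivAt φ (b t) t)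
    (hab : ∀ t, T ≤ t → (a t).re ≤ b t) {t : ℝ} (ht : T ≤ t) :
    ‖F t‖ ≤ ‖F T‖ * Real.exp (φ t - φ T) := by
  have hd := fun t ht => hasDerivAt_norm_sq_mul_exp (hF t ht) (hφ t ht)
  have hanti := antitoneOn_of_hasDerivWithinAt_nonpos (convex_Ici T)
    (fun t ht => (hd t ht).continuousAt.continuousWithinAt)
    (fun t ht => (hd t (interior_subset ht)).hasDerivWithinAt)
    (fun t ht => mul_nonpos_of_nonpos_of_nonneg
      (by linarith [hab t (interior_subset ht)]) (by positivity))
  exact (sq_mul_exp_le_iff (norm_nonneg _) (norm_nonneg _)).1 (hanti Set.self_mem_Ici ht ht)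

lemma mul_exp_le_norm_of_le_re {F a : ℝ → ℂ} {φ b : ℝ → ℝ} {T : ℝ}
    (hF : ∀ t, T ≤ t → HasDerivAt F (a t * F t) t) (hφ : ∀ t, T ≤ t → HasDerivAt φ (b t) t)
    (hab : ∀ t, T ≤ t → b t ≤ (a t).re) {t : ℝ} (ht : T ≤ t) :
    ‖F T‖ ≤ ‖F t‖ * Real.exp (φ T - φ t) := by
  have hd := fun t ht => hasDerivAt_norm_sq_mul_exp (hF t ht) (hφ t ht)
  have hmono := monotoneOn_of_hasDerivWithinAt_nonneg (convex_Ici T)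
    (fun t ht => (hd t ht).continuousAt.continuousWithinAt)
    (fun t ht => (hd t (interior_subset ht)).hasDerivWithinAt)
    (fun t ht => mul_nonneg
      (by linarith [hab t (interior_subset ht)]) (by positivity))
  exact (sq_mul_exp_le_iff (norm_nonneg _) (norm_nonneg _)).1 (hmono Set.self_mem_Ici ht ht)

/-- The possible limits of `f / deriv f` at the top of the upper half-plane. -/
def equilibria : Set ℂ := {1, -1, I, -I, 2 * I}

lemma one_le_dist_of_mem_equilibria {a b : ℂ} (ha : a ∈ equilibria) (hb : b ∈ equilibria)
    (hab : a ≠ b) : 1 ≤ dist a b := by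
  rw [dist_eq_norm, ← one_le_sq_iff₀ (norm_nonneg _), ← normSq_eq_norm_sq]
  simp only [equilibria, Set.mem_insert_iff, Set.mem_singleton_iff] at ha hb
  rcases ha with rfl | rfl | rfl | rfl | rfl <;> rcases hb with rfl | rfl | rfl | rfl | rfl <;>
    first
    | exact absurd rfl hab
    | (norm_num [normSq_apply])

lemma exists_mem_equilibria_norm_sub_lt {v : ℂ} {δ : ℝ} (hδ : 0 < δ)
    (h : ‖(v ^ 4 - 1) * (v - 2 * I)‖ < δ ^ 5) : ∃ e ∈ equilibria, ‖v - e‖ < δ := by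
  by_contra! hcon
  have h1 := hcon 1 (by simp [equilibria])
  have h2 := hcon (-1) (by simp [equilibria])
  have h3 := hcon I (by simp [equilibria])
  have h4 := hcon (-I) (by simp [equilibria])
  have h5 := hcon (2 * I) (by simp [equilibria])
  have e : (v ^ 4 - 1) * (v - 2 * I) =
      (v - 1) * (v - -1) * (v - I) * (v - -I) * (v - 2 * I) := by
    linear_combination (v - 1) * (v + 1) * (v - 2 * I) * I_sq
  rw [e, norm_mul, norm_mul, norm_mul, norm_mul] at h
  have : δ ^ 5 ≤ ‖v - 1‖ * ‖v - -1‖ * ‖v - I‖ * ‖v - -I‖ * ‖v - 2 * I‖ := by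
    calc δ ^ 5 = δ * δ * δ * δ * δ := by ring
      _ ≤ _ := by gcongr
  linarith

lemma IsPreconnected.exists_forall_dist_lt {X E : Type*} [TopologicalSpace X]
    [PseudoMetricSpace E] {S : Set X} (hS : IsPreconnected S) (hne : S.Nonempty) {v : X → E}
    (hv : ContinuousOn v S) {P : Set E} {δ : ℝ}
    (hP : ∀ a ∈ P, ∀ b ∈ P, a ≠ b → 2 * δ ≤ dist a b)
    (h : ∀ x ∈ S, ∃ e ∈ P, dist (v x) e < δ) :
    ∃ e ∈ P, ∀ x ∈ S, dist (v x) e < δ := by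
  obtain ⟨x₀, hx₀⟩ := hne
  obtain ⟨e, heP, he⟩ := h x₀ hx₀
  refine ⟨e, heP, fun x hx => ?_⟩
  have key : v '' S ⊆ Metric.ball e δ := by
    refine (hS.image v hv).subset_left_of_subset_union (u := Metric.ball e δ)
      (v := ⋃ a ∈ P \ {e}, Metric.ball a δ) Metric.isOpen_ball
      (isOpen_biUnion fun _ _ => Metric.isOpen_ball) ?_ ?_ ⟨v x₀, ⟨x₀, hx₀, rfl⟩, he⟩
    · refine Set.disjoint_iUnion₂_right.2 fun a ha => Metric.ball_disjoint_ball ?_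
      have := hP e heP a ha.1 (fun h => ha.2 h.symm)
      linarith
    · rintro _ ⟨y, hy, rfl⟩
      obtain ⟨a, ha, hya⟩ := h y hy
      by_cases hae : a = e
      · subst hae; exact Or.inl hya
      · exact Or.inr (Set.mem_biUnion ⟨ha, hae⟩ hya)
  exact key ⟨x, hx, rfl⟩

/-- A quarter of the logarithmic derivative of `cos (2 z)`. -/
noncomputable def quarterLogDerivCos (z : ℂ) : ℂ := -(sin (2 * z) / (2 * cos (2 * z)))

namespace IsFermatSolution

variable {f : ℂ → ℂ}

lemma div_pow_sub_one (hf : IsFermatSolution f) {z : ℂ} (hz : 1 ≤ z.im) :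
    (f z / deriv f z) ^ 4 - 1 = cos (2 * z) / deriv f z ^ 4 := by
  have := hf.deriv_ne_zero hz
  rw [← hf.eq z]; field_simp

lemma deriv_deriv_eq (hf : IsFermatSolution f) {z : ℂ} (hz : 1 ≤ z.im) :
    deriv (deriv f) z = ((f z / deriv f z) ^ 3 -
      quarterLogDerivCos z * ((f z / deriv f z) ^ 4 - 1)) * deriv f z := by
  have h0 := hf.deriv_ne_zero hz
  have hc := cos_two_mul_ne_zero hz
  have h1 := hf.deriv_eq z
  rw [hf.div_pow_sub_one hz, quarterLogDerivCos]
  field_simp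
  linear_combination -h1

lemma hasDerivAt_div (hf : IsFermatSolution f) {z : ℂ} (hz : 1 ≤ z.im) :
    HasDerivAt (fun z => f z / deriv f z) (((f z / deriv f z) ^ 4 - 1) *
      (f z / deriv f z * quarterLogDerivCos z - 1)) z := by
  have h0 := hf.deriv_ne_zero hz
  refine ((hf.hasDerivAt z).div (hf.hasDerivAt_deriv z) h0).congr_deriv ?_
  rw [hf.deriv_deriv_eq hz]
  generalize hv : f z / deriv f z = v
  have hfv : f z = v * deriv f z := by rw [← hv, div_mul_cancel₀ _ h0]
  rw [hfv]
  field_simp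
  ring

lemma norm_div_le (hf : IsFermatSolution f) {z : ℂ} (hz : 1 ≤ z.im) :
    ‖f z / deriv f z‖ ≤ 161 := by
  rw [norm_div, div_le_iff₀ (norm_pos_iff.2 (hf.deriv_ne_zero hz))]
  exact hf.norm_le_mul_norm_deriv hz

lemma norm_deriv_div_le (hf : IsFermatSolution f) {z : ℂ} (hz : 1 < z.im) :
    ‖deriv (fun z => f z / deriv f z) z‖ ≤ 161 / (z.im - 1) := by
  have hball : ∀ ζ ∈ Metric.closedBall z (z.im - 1), 1 ≤ ζ.im := by
    intro ζ hζ
    have h1 := (abs_im_le_norm (ζ - z)).trans (by simpa [dist_eq_norm] using hζ)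
    rw [sub_im, abs_le] at h1
    linarith
  refine norm_deriv_le_of_forall_mem_sphere_norm_le (by linarith) ?_
    fun ζ hζ => hf.norm_div_le (hball ζ (Metric.sphere_subset_closedBall hζ))
  refine DifferentiableOn.diffContOnCl fun ζ hζ => ?_
  exact (hf.hasDerivAt_div (hball ζ
    (Metric.closure_ball_subset_closedBall hζ))).differentiableAt.differentiableWithinAt

lemma norm_equilibrium_defect_le (hf : IsFermatSolution f) {z : ℂ} (hz : 1 < z.im) :
    ‖((f z / deriv f z) ^ 4 - 1) * (f z / deriv f z - 2 * I)‖ ≤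
      2 * ((161 ^ 4 + 1) * 161 * (2 * Real.exp (-(4 * z.im))) + 161 / (z.im - 1)) := by
  have h1 := hf.norm_deriv_div_le hz
  rw [(hf.hasDerivAt_div hz.le).deriv] at h1
  have h2 : ‖quarterLogDerivCos z + I / 2‖ ≤ _ := norm_tan_add_le hz.le
  have h3 := hf.norm_div_le hz.le
  generalize f z / deriv f z = v at *
  have e : (v ^ 4 - 1) * (v - 2 * I) = 2 * ((-I) * ((v ^ 4 - 1) * v *
      (quarterLogDerivCos z + I / 2) - (v ^ 4 - 1) * (v * quarterLogDerivCos z - 1))) := by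
    linear_combination (v ^ 4 - 1) * v * I_sq
  have h4 : ‖v ^ 4 - 1‖ ≤ 161 ^ 4 + 1 := by
    refine (norm_sub_le _ _).trans ?_
    rw [norm_pow, norm_one]; gcongr
  rw [e, norm_mul, norm_mul, norm_neg, norm_I, one_mul, Complex.norm_two]
  refine mul_le_mul_of_nonneg_left ((norm_sub_le _ _).trans (add_le_add ?_ h1)) two_pos.le
  rw [norm_mul, norm_mul]
  gcongr

lemma exists_equilibrium (hf : IsFermatSolution f) : ∃ e ∈ equilibria, ∃ Y : ℝ, 1 ≤ Y ∧
    ∀ z : ℂ, Y ≤ z.im → ‖f z / deriv f z - e‖ < 1 / 100 ∧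
      ‖quarterLogDerivCos z + I / 2‖ ≤ 1 / 100 := by
  have hexp : Filter.Tendsto (fun y : ℝ => 2 * Real.exp (-(4 * y))) Filter.atTop (nhds 0) := by
    have := (Real.tendsto_exp_neg_atTop_nhds_zero.comp
      (Filter.tendsto_id.const_mul_atTop (by norm_num : (0 : ℝ) < 4))).const_mul 2
    simpa using this
  have hdiv : Filter.Tendsto (fun y : ℝ => 161 / (y - 1)) Filter.atTop (nhds 0) :=
    Filter.Tendsto.div_atTop tendsto_const_nhds
      (Filter.tendsto_atTop_add_const_right _ (-1) Filter.tendsto_id)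
  have hlim := ((hexp.const_mul ((161 ^ 4 + 1) * 161)).add hdiv).const_mul 2
  simp only [mul_zero, add_zero] at hlim
  obtain ⟨Y, hY⟩ := Filter.eventually_atTop.1
    ((hlim.eventually_lt_const (by norm_num : (0 : ℝ) < (1 / 100) ^ 5)).and
      (hexp.eventually_lt_const (by norm_num : (0 : ℝ) < 1 / 100)))
  have hmem : ∀ z ∈ {z : ℂ | max Y 2 ≤ z.im}, ∃ e ∈ equilibria,
      dist (f z / deriv f z) e < 1 / 100 := by
    intro z hz
    have hz2 : 1 < z.im := by linarith [(le_max_right Y 2).trans hz]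
    simp only [dist_eq_norm]
    exact exists_mem_equilibria_norm_sub_lt (by norm_num)
      ((hf.norm_equilibrium_defect_le hz2).trans_lt (hY _ ((le_max_left Y 2).trans hz)).1)
  obtain ⟨e, he, h⟩ := IsPreconnected.exists_forall_dist_lt
    (convex_halfSpace_im_ge (max Y 2)).isPreconnected
    ⟨(max Y 2 : ℝ) * I, by simp⟩
    (fun z hz => (hf.hasDerivAt_div
      (by linarith [(le_max_right Y 2).trans hz])).continuousAt.continuousWithinAt)
    (fun a ha b hb hab => le_trans (by norm_num) (one_le_dist_of_mem_equilibria ha hb hab)) hmem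
  refine ⟨e, he, max Y 2, le_trans (by norm_num) (le_max_right _ _), fun z hz => ⟨?_, ?_⟩⟩
  · rw [← dist_eq_norm]; exact h z hz
  · exact (norm_tan_add_le (by linarith [(le_max_right Y 2).trans hz])).trans
      (hY _ ((le_max_left Y 2).trans hz)).2.le

end IsFermatSolution

lemma HasDerivAt.comp_real_mul {g : ℂ → ℂ} {g' d : ℂ} {t : ℝ} (hg : HasDerivAt g g' (t * d)) :
    HasDerivAt (fun t : ℝ => g (t * d)) (d * g') t := by
  have h1 : HasDerivAt (fun t : ℝ => (t : ℂ) * d) d t := by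
    simpa using ofRealCLM.hasDerivAt.mul_const d
  rw [mul_comm]
  exact hg.comp t h1

lemma re_I_div_le {v e : ℂ} (he : e = 1 ∨ e = -1 ∨ e = -I) (h : ‖v - e‖ < 1 / 100) :
    v ≠ 0 ∧ (I / v).re ≤ 1 / 10 ∧ ‖v‖⁻¹ ≤ 2 := by
  have h1 : ‖e‖ = 1 := by rcases he with rfl | rfl | rfl <;> simp
  have h2 : e.im ≤ 0 := by rcases he with rfl | rfl | rfl <;> simp
  have h3 := norm_sub_norm_le e v
  rw [h1, norm_sub_rev] at h3
  have h4 := (le_abs_self _).trans ((abs_im_le_norm (v - e)))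
  rw [sub_im] at h4
  have hv : 99 / 100 ≤ ‖v‖ := by linarith
  have hv0 : 0 < ‖v‖ := by linarith
  refine ⟨norm_pos_iff.1 hv0, ?_, ?_⟩
  · have : (I / v).re = v.im / ‖v‖ ^ 2 := by
      rw [div_re, normSq_eq_norm_sq]; simp
    rw [this, div_le_iff₀ (by positivity)]
    nlinarith
  · rw [inv_le_comm₀ hv0 two_pos]; linarith

/-- Estimates for `v` close to the equilibrium `I`. -/
lemma norm_estimates_near_I {v τ : ℂ} (hv : ‖v - I‖ < 1 / 100) (hτ : ‖τ + I / 2‖ ≤ 1 / 100) :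
    ‖v - I‖ ≤ ‖v ^ 4 - 1‖ ∧ ‖v ^ 4 - 1‖ ≤ 9 / 200 ∧
      ‖v ^ 3 - τ * (v ^ 4 - 1) + I‖ ≤ 5 * ‖v ^ 4 - 1‖ := by
  have hvI : ‖v‖ ≤ 101 / 100 := by
    have := norm_sub_norm_le v I
    rw [norm_I] at this; linarith
  have hτ1 : ‖τ‖ ≤ 1 := by
    have := norm_sub_norm_le τ (-(I / 2))
    rw [norm_neg, norm_div, norm_I, Complex.norm_two, sub_neg_eq_add] at this; linarith
  have hp : ‖v + I‖ ≤ 201 / 100 := (norm_add_le _ _).trans (by rw [norm_I]; linarith)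
  have hp' : 1 ≤ ‖v + I‖ := by
    have h1 : v + I = 2 * I - -(v - I) := by ring
    have := norm_sub_norm_le (2 * I) (-(v - I))
    rw [norm_neg, norm_mul, norm_I, Complex.norm_two] at this
    rw [h1]; linarith
  have hm : ‖v ^ 2 - 1‖ ≤ 203 / 100 := (norm_sub_le _ _).trans (by
    rw [norm_pow, norm_one]; nlinarith [norm_nonneg v])
  have hprod : ‖(v - I) * (v + I)‖ ≤ 3 / 100 := by
    rw [norm_mul]; nlinarith [norm_nonneg (v - I), norm_nonneg (v + I)]
  have hm' : 1 ≤ ‖v ^ 2 - 1‖ := by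
    have h1 : v ^ 2 - 1 = -(2 - (v - I) * (v + I)) := by linear_combination I_sq
    have := norm_sub_norm_le 2 ((v - I) * (v + I))
    rw [Complex.norm_two] at this
    rw [h1, norm_neg]; linarith
  have hE : ‖v ^ 4 - 1‖ = ‖v - I‖ * ‖v + I‖ * ‖v ^ 2 - 1‖ := by
    rw [← norm_mul, ← norm_mul]
    congr 1
    linear_combination (v ^ 2 - 1) * I_sq
  have h0 := norm_nonneg (v - I)
  have hle : ‖v - I‖ ≤ ‖v ^ 4 - 1‖ := by
    rw [hE, mul_assoc]
    exact le_mul_of_one_le_right h0 (one_le_mul_of_one_le_of_one_le hp' hm')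
  refine ⟨hle, ?_, ?_⟩
  · rw [hE]
    calc ‖v - I‖ * ‖v + I‖ * ‖v ^ 2 - 1‖ ≤ 1 / 100 * (201 / 100) * (203 / 100) := by gcongr
      _ ≤ 9 / 200 := by norm_num
  · have e : v ^ 3 - τ * (v ^ 4 - 1) + I =
        (v - I) * (v ^ 2 + I * v - 1) - τ * (v ^ 4 - 1) := by
      linear_combination (v * I_sq)
    have h4 : ‖v ^ 2 + I * v - 1‖ ≤ 4 := by
      refine (norm_sub_le _ _).trans ((add_le_add_left (norm_add_le _ _) _).trans ?_)
      rw [norm_pow, norm_mul, norm_I, norm_one]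
      nlinarith [norm_nonneg v]
    rw [e]
    refine (norm_sub_le _ _).trans ?_
    rw [norm_mul, norm_mul]
    nlinarith [norm_nonneg (v ^ 4 - 1)]

/-- Estimates for `v` close to the equilibrium `2 * I`. -/
lemma norm_estimates_near_two_I {v τ : ℂ} (hv : ‖v - 2 * I‖ < 1 / 100)
    (hτ : ‖τ + I / 2‖ ≤ 1 / 100) :
    1 ≤ ‖v ^ 4 - 1‖ ∧ ‖v ^ 4 - 1‖ ≤ 16 ∧ ‖(v ^ 4 - 1) * τ + 15 / 2 * I‖ ≤ 1 := by
  have hI : ‖2 * I‖ = 2 := by simp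
  have hvI : ‖v‖ ≤ 201 / 100 := by
    have := norm_sub_norm_le v (2 * I)
    rw [hI] at this; linarith
  have hτ1 : ‖τ‖ ≤ 51 / 100 := by
    have := norm_sub_norm_le τ (-(I / 2))
    rw [norm_neg, norm_div, norm_I, Complex.norm_two, sub_neg_eq_add] at this; linarith
  have hp : ‖v + 2 * I‖ ≤ 401 / 100 := (norm_add_le _ _).trans (by rw [hI]; linarith)
  have hm : ‖v ^ 2 - 4‖ ≤ 9 := (norm_sub_le _ _).trans (by
    rw [norm_pow]; norm_num; nlinarith [norm_nonneg v])
  have hD : ‖v ^ 4 - 16‖ ≤ 37 / 100 := by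
    have e : v ^ 4 - 16 = (v - 2 * I) * (v + 2 * I) * (v ^ 2 - 4) := by
      linear_combination 4 * (v ^ 2 - 4) * I_sq
    rw [e, norm_mul, norm_mul]
    calc ‖v - 2 * I‖ * ‖v + 2 * I‖ * ‖v ^ 2 - 4‖ ≤ 1 / 100 * (401 / 100) * 9 := by gcongr
      _ ≤ 37 / 100 := by norm_num
  have h15 : ‖(15 : ℂ)‖ = 15 := by norm_num
  refine ⟨?_, ?_, ?_⟩
  · have := norm_sub_norm_le 15 (-(v ^ 4 - 16))
    rw [norm_neg, h15] at this
    have e : v ^ 4 - 1 = 15 - -(v ^ 4 - 16) := by ring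
    rw [e]; linarith
  · have e : v ^ 4 - 1 = 15 + (v ^ 4 - 16) := by ring
    rw [e]
    refine (norm_add_le _ _).trans ?_
    rw [h15]; linarith
  · have e : (v ^ 4 - 1) * τ + 15 / 2 * I = (v ^ 4 - 16) * τ + 15 * (τ + I / 2) := by ring
    rw [e]
    refine (norm_add_le _ _).trans ?_
    rw [norm_mul, norm_mul, h15]
    nlinarith [norm_nonneg (v ^ 4 - 16), norm_nonneg τ]

namespace IsFermatSolution

variable {f : ℂ → ℂ} {Y : ℝ}

lemma equilibrium_eq_I_or_two_I (hf : IsFermatSolution f) {e : ℂ} (he : e ∈ equilibria)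
    (hY : 1 ≤ Y) (h : ∀ z : ℂ, Y ≤ z.im → ‖f z / deriv f z - e‖ < 1 / 100) :
    e = I ∨ e = 2 * I := by
  by_contra! hne
  have he' : e = 1 ∨ e = -1 ∨ e = -I := by
    simp only [equilibria, Set.mem_insert_iff, Set.mem_singleton_iff] at he
    tauto
  have him : ∀ t : ℝ, ((t : ℂ) * I).im = t := fun t => by simp
  have hest := fun (t : ℝ) (ht : Y ≤ t) => re_I_div_le he' (h (t * I) (by rwa [him]))
  have hgrow : ∀ t, Y ≤ t → ‖f (t * I)‖ ≤ ‖f (Y * I)‖ * Real.exp (t / 10 - Y / 10) := by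
    intro t ht
    refine norm_le_mul_exp_of_re_le (F := fun t : ℝ => f (t * I))
      (a := fun t => I / (f (t * I) / deriv f (t * I))) (b := fun _ => 1 / 10)
      (φ := fun t => t / 10) (fun s hs => ?_) (fun s _ => (hasDerivAt_id s).div_const 10)
      (fun s hs => (hest s hs).2.1) ht
    refine (hf.hasDerivAt _).comp_real_mul.congr_deriv ?_
    have hv := (hest s hs).1
    have h1 : f (s * I) ≠ 0 := fun h0 => hv (by rw [h0, zero_div])
    rw [div_div_eq_mul_div, div_mul_cancel₀ _ h1]
  set K := ‖f (Y * I)‖ ^ 4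
  have hK : 0 ≤ K := by positivity
  set t := max Y (68 * K) with ht
  have hYt : Y ≤ t := le_max_left _ _
  have h1 := exp_div_four_le_norm_cos (z := t * I) (by rw [him]; linarith)
  rw [← hf.eq, him] at h1
  have h2 : ‖deriv f (t * I)‖ ≤ 2 * ‖f (t * I)‖ := by
    have h3 := (hest t hYt).2.2
    have hv := (hest t hYt).1
    have h0 : f (t * I) ≠ 0 := fun h0 => hv (by rw [h0, zero_div])
    rw [norm_div, inv_div, div_le_iff₀ (norm_pos_iff.2 h0)] at h3
    exact h3
  have h3 : ‖f (t * I) ^ 4 - deriv f (t * I) ^ 4‖ ≤ 17 * ‖f (t * I)‖ ^ 4 := by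
    refine (norm_sub_le _ _).trans ?_
    rw [norm_pow, norm_pow]
    have : ‖deriv f (t * I)‖ ^ 4 ≤ (2 * ‖f (t * I)‖) ^ 4 := by gcongr
    linarith
  have h4 : ‖f (t * I)‖ ^ 4 ≤ K * Real.exp t := by
    calc ‖f (t * I)‖ ^ 4 ≤ (‖f (Y * I)‖ * Real.exp (t / 10 - Y / 10)) ^ 4 := by
          gcongr; exact hgrow t hYt
      _ = K * Real.exp (4 * (t / 10 - Y / 10)) := by
          rw [mul_pow, ← Real.exp_nat_mul]; norm_num [K]
      _ ≤ K * Real.exp t := by gcongr; linarith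
  have h5 : Real.exp t * Real.exp t ≤ 68 * K * Real.exp t := by
    rw [← Real.exp_add, ← two_mul]; linarith
  have h6 := le_of_mul_le_mul_right h5 (Real.exp_pos t)
  have h7 := Real.add_one_le_exp t
  linarith [le_max_right Y (68 * K)]

lemma norm_deriv_pow_mul (hf : IsFermatSolution f) {z : ℂ} (hz : 1 ≤ z.im) :
    ‖(f z / deriv f z) ^ 4 - 1‖ * ‖deriv f z‖ ^ 4 ≤ Real.exp (2 * z.im) := by
  rw [hf.div_pow_sub_one hz, norm_div, norm_pow, div_mul_cancel₀ _
    (by have := hf.deriv_ne_zero hz; positivity)]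
  exact norm_cos_two_mul_le (abs_of_pos (by linarith)).le

lemma norm_sub_mul_deriv (hf : IsFermatSolution f) {z : ℂ} (hz : 1 ≤ z.im) (e : ℂ) :
    ‖f z - e * deriv f z‖ = ‖f z / deriv f z - e‖ * ‖deriv f z‖ := by
  rw [← norm_mul, sub_mul, div_mul_cancel₀ _ (hf.deriv_ne_zero hz)]

lemma bounds_of_near_I (hf : IsFermatSolution f) (hY : 1 ≤ Y)
    (h : ∀ z : ℂ, Y ≤ z.im → ‖f z / deriv f z - I‖ < 1 / 100 ∧
      ‖quarterLogDerivCos z + I / 2‖ ≤ 1 / 100)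
    {d : ℂ} (hd : d.im = 1) (hd2 : ‖d‖ ≤ 2) :
    ∃ C, ∀ t : ℝ, Y ≤ t → ‖deriv f (t * d)‖ ≤ C * Real.exp t ∧
      ‖f (t * d) - I * deriv f (t * d)‖ ≤ C * Real.exp (-t) := by
  have him : ∀ t : ℝ, ((t : ℂ) * d).im = t := fun t => by simp [hd]
  have hest := fun (t : ℝ) (ht : Y ≤ t) => norm_estimates_near_I
    (h (t * d) (by rwa [him])).1 (h (t * d) (by rwa [him])).2
  have hpow := fun (t : ℝ) (ht : Y ≤ t) =>
    hf.norm_deriv_pow_mul (z := t * d) (by rw [him]; linarith)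
  simp only [him] at hpow
  set F : ℝ → ℂ := fun t => deriv f (t * d) with hFdef
  set E : ℝ → ℝ := fun t => ‖(f (t * d) / deriv f (t * d)) ^ 4 - 1‖ with hEdef
  set a : ℝ → ℂ := fun t => d * ((f (t * d) / deriv f (t * d)) ^ 3 - quarterLogDerivCos (t * d) *
    ((f (t * d) / deriv f (t * d)) ^ 4 - 1)) with hadef
  have hF : ∀ t, Y ≤ t → HasDerivAt F (a t * F t) t := by
    intro t ht
    refine (hf.hasDerivAt_deriv _).comp_real_mul.congr_deriv ?_
    rw [hf.deriv_deriv_eq (by rw [him]; linarith), hadef, mul_assoc]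
  have ha : ∀ t, Y ≤ t → |(a t).re - 1| ≤ 10 * E t := by
    intro t ht
    have h1 : (a t).re - 1 = (d * ((f (t * d) / deriv f (t * d)) ^ 3 - quarterLogDerivCos (t * d) *
        ((f (t * d) / deriv f (t * d)) ^ 4 - 1) + I)).re := by
      rw [mul_add, add_re, hadef]; simp [hd]; ring
    rw [h1]
    refine (abs_re_le_norm _).trans ?_
    rw [norm_mul]
    have := (hest t ht).2.2
    nlinarith [norm_nonneg d, norm_nonneg ((f (t * d) / deriv f (t * d)) ^ 4 - 1)]
  have hFpos : ∀ t, Y ≤ t → 0 < ‖F t‖ := fun t ht =>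
    norm_pos_iff.2 (hf.deriv_ne_zero (by rw [him]; linarith))
  -- a lower bound for `F` yields decay of `E`
  have hdecay : ∀ σ M t : ℝ, Y ≤ t → ‖F Y‖ ≤ ‖F t‖ * Real.exp (M - σ * t) →
      E t ≤ (Real.exp (4 * M) / ‖F Y‖ ^ 4) * Real.exp ((2 - 4 * σ) * t) := by
    intro σ M t ht hle
    have h0 := hFpos Y le_rfl
    have h1 := hpow t ht
    have h2 : ‖F Y‖ ^ 4 ≤ ‖F t‖ ^ 4 * Real.exp (4 * (M - σ * t)) := by
      calc ‖F Y‖ ^ 4 ≤ (‖F t‖ * Real.exp (M - σ * t)) ^ 4 := by gcongr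
        _ = _ := by rw [mul_pow, ← Real.exp_nat_mul]; norm_num
    rw [div_mul_eq_mul_div, le_div_iff₀ (by positivity), ← Real.exp_add]
    calc E t * ‖F Y‖ ^ 4 ≤ E t * (‖F t‖ ^ 4 * Real.exp (4 * (M - σ * t))) := by gcongr
      _ = (E t * ‖F t‖ ^ 4) * Real.exp (4 * (M - σ * t)) := by ring
      _ ≤ Real.exp (2 * t) * Real.exp (4 * (M - σ * t)) := by gcongr
      _ = _ := by rw [← Real.exp_add]; ring_nf
  have hlow : ∀ t, Y ≤ t → ‖F Y‖ ≤ ‖F t‖ * Real.exp (11 / 20 * Y - 11 / 20 * t) := by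
    intro t ht
    refine mul_exp_le_norm_of_le_re (b := fun _ => 11 / 20) (φ := fun t => 11 / 20 * t) hF
      (fun s _ => by simpa using (hasDerivAt_id s).const_mul (11 / 20 : ℝ)) (fun s hs => ?_) ht
    have h1 := (abs_le.1 (ha s hs)).1
    have h2 : E s ≤ 9 / 200 := (hest s hs).2.1
    linarith
  set K := 10 * (Real.exp (4 * (11 / 20 * Y)) / ‖F Y‖ ^ 4) with hK
  have hK0 : 0 ≤ K := by positivity
  have hE : ∀ t, Y ≤ t → 10 * E t ≤ K * Real.exp (-(1 / 5 * t)) := by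
    intro t ht
    have := hdecay _ _ t ht (hlow t ht)
    have e : (2 - 4 * (11 / 20)) * t = -(1 / 5 * t) := by ring
    rw [e] at this
    rw [hK]; linarith
  have hφ : ∀ c s : ℝ, HasDerivAt (fun t : ℝ => t - 5 * c * Real.exp (-(1 / 5 * t)))
      (1 + c * Real.exp (-(1 / 5 * s))) s := by
    intro c s
    refine ((hasDerivAt_id s).sub ((((hasDerivAt_id s).const_mul (1 / 5 : ℝ)).neg.exp).const_mul
      (5 * c))).congr_deriv ?_
    simp; ring
  have hexp1 : ∀ t, Y ≤ t → Real.exp (-(1 / 5 * t)) ≤ 1 := fun t ht =>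
    Real.exp_le_one_iff.2 (by linarith)
  have hexp0 : ∀ t : ℝ, 0 ≤ Real.exp (-(1 / 5 * t)) := fun t => (Real.exp_pos _).le
  have hup : ∀ t, Y ≤ t → ‖F t‖ ≤ ‖F Y‖ * Real.exp (5 * K) * Real.exp t := by
    intro t ht
    refine (norm_le_mul_exp_of_re_le hF (fun s _ => hφ K s) (fun s hs => ?_) ht).trans ?_
    · have h1 := (abs_le.1 (ha s hs)).2
      linarith [hE s hs]
    · rw [mul_assoc ‖F Y‖, ← Real.exp_add]
      refine mul_le_mul_of_nonneg_left (Real.exp_le_exp.2 ?_) (norm_nonneg _)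
      nlinarith [hexp1 Y le_rfl, hexp0 t]
  have hlow' : ∀ t, Y ≤ t → ‖F Y‖ ≤ ‖F t‖ * Real.exp (Y + 5 * K - 1 * t) := by
    intro t ht
    refine (mul_exp_le_norm_of_le_re hF (fun s _ => hφ (-K) s) (fun s hs => ?_) ht).trans ?_
    · have h1 := (abs_le.1 (ha s hs)).1
      linarith [hE s hs]
    · refine mul_le_mul_of_nonneg_left (Real.exp_le_exp.2 ?_) (norm_nonneg _)
      nlinarith [hexp1 Y le_rfl, hexp0 t]
  set A := ‖F Y‖ * Real.exp (5 * K)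
  set B := Real.exp (4 * (Y + 5 * K)) / ‖F Y‖ ^ 4
  have hA : 0 ≤ A := by positivity
  have hB : 0 ≤ B := by positivity
  refine ⟨A + B * A, fun t ht => ⟨(hup t ht).trans ?_, ?_⟩⟩
  · gcongr; nlinarith
  · rw [hf.norm_sub_mul_deriv (by rw [him]; linarith)]
    have h1 := (hest t ht).1.trans (hdecay 1 _ t ht (hlow' t ht))
    calc _ ≤ B * Real.exp ((2 - 4 * 1) * t) * (A * Real.exp t) := by
          gcongr; exact hup t ht
      _ = B * A * (Real.exp ((2 - 4 * 1) * t) * Real.exp t) := by ring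
      _ = B * A * Real.exp (-t) := by rw [← Real.exp_add]; ring_nf
      _ ≤ _ := by gcongr; linarith

lemma bounds_of_near_two_I (hf : IsFermatSolution f) (hY : 1 ≤ Y)
    (h : ∀ z : ℂ, Y ≤ z.im → ‖f z / deriv f z - 2 * I‖ < 1 / 100 ∧
      ‖quarterLogDerivCos z + I / 2‖ ≤ 1 / 100)
    {d : ℂ} (hd : d.im = 1) (hd2 : ‖d‖ ≤ 2) {t : ℝ} (ht : Y ≤ t) :
    ‖deriv f (t * d)‖ ≤ Real.exp t ∧
      ‖f (t * d) - 2 * I * deriv f (t * d)‖ ≤ Real.exp (-t) := by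
  have him : ∀ t : ℝ, ((t : ℂ) * d).im = t := fun t => by simp [hd]
  have hest := fun (t : ℝ) (ht : Y ≤ t) => norm_estimates_near_two_I
    (h (t * d) (by rwa [him])).1 (h (t * d) (by rwa [him])).2
  have hF : ‖deriv f (t * d)‖ ≤ Real.exp (t / 2) := by
    have h1 := hf.norm_deriv_pow_mul (z := t * d) (by rw [him]; linarith)
    rw [him] at h1
    refine le_of_pow_le_pow_left₀ (n := 4) (by norm_num) (by positivity) ?_
    rw [← Real.exp_nat_mul]
    have e : ((4 : ℕ) : ℝ) * (t / 2) = 2 * t := by push_cast; ring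
    rw [e]
    exact (le_mul_of_one_le_left (by positivity) (hest t ht).1).trans h1
  refine ⟨hF.trans (Real.exp_le_exp.2 (by linarith)), ?_⟩
  set r : ℝ → ℂ := fun t => f (t * d) / deriv f (t * d) - 2 * I with hr
  have hr1 : ∀ s, Y ≤ s → ‖r s‖ ≤ 1 / 100 := fun s hs => (h (s * d) (by rwa [him])).1.le
  have hGderiv : ∀ s, Y ≤ s → ∃ D, 0 ≤ D ∧ HasDerivAt
      (fun s => ‖r s‖ ^ 2 * Real.exp (-(8 * s)) - 1 / 4 * Real.exp (-(12 * s))) D s := by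
    intro s hs
    have hs1 : 1 ≤ ((s : ℂ) * d).im := by rw [him]; linarith
    have h1 := ((hf.hasDerivAt_div hs1).sub_const (2 * I)).comp_real_mul
    obtain ⟨e1, e2, e3⟩ := hest s hs
    have hτ : ‖quarterLogDerivCos (s * d) + I / 2‖ ≤ _ := norm_tan_add_le hs1
    rw [him] at hτ
    have hrs := hr1 s hs
    simp only [hr] at hrs
    have hd1 : HasDerivAt (fun s : ℝ => Real.exp (-(8 * s))) (-8 * Real.exp (-(8 * s))) s := by
      refine ((hasDerivAt_id s).const_mul (8 : ℝ)).neg.exp.congr_deriv ?_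
      simp; ring
    have hd3 : HasDerivAt (fun s : ℝ => 1 / 4 * Real.exp (-(12 * s)))
        (-3 * Real.exp (-(12 * s))) s := by
      refine (((hasDerivAt_id s).const_mul (12 : ℝ)).neg.exp.const_mul (1 / 4)).congr_deriv ?_
      simp; ring
    refine ⟨_, ?_, (h1.norm_sq.mul hd1).sub hd3⟩
    generalize f (s * d) / deriv f (s * d) = v at *
    generalize quarterLogDerivCos (s * d) = τ at *
    have e4 : d * ((v ^ 4 - 1) * (v * τ - 1)) = d * ((v ^ 4 - 1) * τ) * (v - 2 * I) +
        d * (v ^ 4 - 1) * (2 * I * (τ + I / 2)) := by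
      linear_combination (-d * (v ^ 4 - 1)) * I_sq
    have e5 : 11 / 2 ≤ (d * ((v ^ 4 - 1) * τ)).re := by
      have h2 : (d * ((v ^ 4 - 1) * τ)).re = 15 / 2 +
          (d * ((v ^ 4 - 1) * τ + 15 / 2 * I)).re := by
        rw [mul_add d, add_re]
        have : (d * (15 / 2 * I)).re = -(15 / 2) := by
          have : d * (15 / 2 * I) = ((15 / 2 : ℝ) : ℂ) * (d * I) := by push_cast; ring
          rw [this, re_ofReal_mul]; simp [hd]
        rw [this]; ring
      have h3 := (abs_le.1 (abs_re_le_norm (d * ((v ^ 4 - 1) * τ + 15 / 2 * I)))).1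
      rw [norm_mul] at h3
      nlinarith [norm_nonneg d, norm_nonneg ((v ^ 4 - 1) * τ + 15 / 2 * I)]
    have e6 : ‖d * (v ^ 4 - 1) * (2 * I * (τ + I / 2))‖ ≤ 128 * Real.exp (-(4 * s)) := by
      rw [norm_mul, norm_mul, norm_mul, norm_mul, norm_I, Complex.norm_two]
      calc ‖d‖ * ‖v ^ 4 - 1‖ * (2 * 1 * ‖τ + I / 2‖)
          ≤ 2 * 16 * (2 * 1 * (2 * Real.exp (-(4 * s)))) := by gcongr
        _ = _ := by ring
    have e7 : 8 * ‖v - 2 * I‖ ^ 2 - 3 * Real.exp (-(4 * s)) ≤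
        2 * inner ℝ (v - 2 * I) (d * ((v ^ 4 - 1) * (v * τ - 1))) := by
      rw [e4, inner_add_right]
      have h2 : inner ℝ (v - 2 * I) (d * ((v ^ 4 - 1) * τ) * (v - 2 * I)) =
          (d * ((v ^ 4 - 1) * τ)).re * ‖v - 2 * I‖ ^ 2 := by
        rw [Complex.inner, mul_assoc _ (v - 2 * I), mul_conj, ← normSq_eq_norm_sq, re_mul_ofReal]
      have h3 := (abs_le.1 (abs_real_inner_le_norm (v - 2 * I)
        (d * (v ^ 4 - 1) * (2 * I * (τ + I / 2))))).1
      rw [h2]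
      have h4 : ‖v - 2 * I‖ * ‖d * (v ^ 4 - 1) * (2 * I * (τ + I / 2))‖ ≤
          1 / 100 * (128 * Real.exp (-(4 * s))) := by gcongr
      nlinarith [sq_nonneg ‖v - 2 * I‖, Real.exp_pos (-(4 * s))]
    have e8 : Real.exp (-(12 * s)) = Real.exp (-(4 * s)) * Real.exp (-(8 * s)) := by
      rw [← Real.exp_add]; ring_nf
    rw [e8]
    nlinarith [Real.exp_pos (-(8 * s))]
  choose! D hD0 hD using hGderiv
  have hmono := monotoneOn_of_hasDerivWithinAt_nonneg (convex_Ici Y)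
    (fun s hs => (hD s hs).continuousAt.continuousWithinAt)
    (fun s hs => (hD s (interior_subset hs)).hasDerivWithinAt)
    (fun s hs => hD0 s (interior_subset hs))
  have hlim : Filter.Tendsto (fun s : ℝ => Real.exp (-(8 * s))) Filter.atTop (nhds 0) :=
    Real.tendsto_exp_neg_atTop_nhds_zero.comp
      (Filter.tendsto_id.const_mul_atTop (by norm_num : (0 : ℝ) < 8))
  have hG : ‖r t‖ ^ 2 * Real.exp (-(8 * t)) - 1 / 4 * Real.exp (-(12 * t)) ≤ 0 := by
    refine ge_of_tendsto hlim (Filter.eventually_atTop.2 ⟨t, fun s hs => ?_⟩)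
    refine (hmono ht (ht.trans hs) hs).trans ?_
    have h1 := hr1 s (ht.trans hs)
    have h2 : ‖r s‖ ^ 2 ≤ 1 := by nlinarith [norm_nonneg (r s)]
    have := mul_le_mul_of_nonneg_right h2 (Real.exp_pos (-(8 * s))).le
    linarith [Real.exp_pos (-(12 * s))]
  have hrt : ‖r t‖ ≤ Real.exp (-(2 * t)) := by
    refine le_of_pow_le_pow_left₀ (n := 2) (by norm_num) (by positivity) ?_
    have e0 : ((2 : ℕ) : ℝ) * -(2 * t) = -(4 * t) := by push_cast; ring
    have e8 : Real.exp (-(12 * t)) = Real.exp (-(4 * t)) * Real.exp (-(8 * t)) := by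
      rw [← Real.exp_add]; ring_nf
    rw [e8] at hG
    rw [← Real.exp_nat_mul, e0]
    refine le_of_mul_le_mul_right ?_ (Real.exp_pos (-(8 * t)))
    have : 0 < Real.exp (-(4 * t)) * Real.exp (-(8 * t)) := by positivity
    linarith
  rw [hf.norm_sub_mul_deriv (by rw [him]; linarith)]
  calc _ ≤ Real.exp (-(2 * t)) * Real.exp (t / 2) := by gcongr
    _ = Real.exp (-(3 / 2 * t)) := by rw [← Real.exp_add]; ring_nf
    _ ≤ _ := Real.exp_le_exp.2 (by linarith)

end IsFermatSolution

lemma exists_bound_Ici_zero {g : ℝ → ℂ} {φ : ℝ → ℝ} {Y C : ℝ} (hg : Continuous g)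
    (hφ : Continuous φ) (hpos : ∀ t, 0 < φ t) (h : ∀ t, Y ≤ t → ‖g t‖ ≤ C * φ t) :
    ∃ C', ∀ t, 0 ≤ t → ‖g t‖ ≤ C' * φ t := by
  obtain ⟨M, hM⟩ := (isCompact_Icc (a := (0 : ℝ)) (b := Y)).exists_bound_of_continuousOn
    (f := fun t => ‖g t‖ / φ t) (hg.norm.div hφ fun t => (hpos t).ne').continuousOn
  refine ⟨max M C, fun t ht => ?_⟩
  rcases le_total t Y with hY | hY
  · have h1 := (le_abs_self _).trans (hM t ⟨ht, hY⟩)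
    rw [div_le_iff₀ (hpos t)] at h1
    exact h1.trans (mul_le_mul_of_nonneg_right (le_max_left _ _) (hpos t).le)
  · exact (h t hY).trans (mul_le_mul_of_nonneg_right (le_max_right _ _) (hpos t).le)

/-- An entire function of exponential type that is bounded on both diagonals is constant. -/
lemma exists_const_of_bounded_on_diagonals {k : ℂ → ℂ} (hk : Differentiable ℂ k) {A B C : ℝ}
    (hexp : ∀ z, ‖k z‖ ≤ A * Real.exp (B * ‖z‖)) (h₁ : ∀ t : ℝ, ‖k (t * (1 + I))‖ ≤ C)
    (h₂ : ∀ t : ℝ, ‖k (t * (-1 + I))‖ ≤ C) : ∃ γ, ∀ z, k z = γ := by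
  have hne : (1 + I) ≠ 0 := fun h => by simpa using congrArg re h
  set K : ℂ → ℂ := fun z => k (z * (1 + I)) with hK
  have hKd : Differentiable ℂ K := hk.comp (differentiable_id.mul_const _)
  have hB : ∀ l : Filter ℂ, ∃ c < (2 : ℝ), ∃ B' : ℝ,
      K =O[l] fun z => Real.exp (B' * ‖z‖ ^ c) := by
    refine fun l => ⟨1, one_lt_two, B * ‖1 + I‖, Asymptotics.IsBigO.of_bound A ?_⟩
    filter_upwards with z
    rw [Real.norm_of_nonneg (Real.exp_pos _).le, Real.rpow_one, mul_assoc, mul_comm ‖1 + I‖,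
      ← norm_mul]
    exact hexp _
  have hre : ∀ x : ℝ, ‖K x‖ ≤ C := h₁
  have him : ∀ x : ℝ, ‖K (x * I)‖ ≤ C := by
    intro x
    have e : (x * I) * (1 + I) = x * (-1 + I) := by linear_combination (x : ℂ) * I_sq
    simp only [hK, e]
    exact h₂ x
  have hbound : ∀ z, ‖K z‖ ≤ C := by
    intro z
    rcases le_total 0 z.re with hr | hr <;> rcases le_total 0 z.im with hi | hi
    · exact PhragmenLindelof.quadrant_I hKd.diffContOnCl (hB _) (fun x _ => hre x)
        (fun x _ => him x) hr hi
    · exact PhragmenLindelof.quadrant_IV hKd.diffContOnCl (hB _) (fun x _ => hre x)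
        (fun x _ => him x) hr hi
    · exact PhragmenLindelof.quadrant_II hKd.diffContOnCl (hB _) (fun x _ => hre x)
        (fun x _ => him x) hr hi
    · exact PhragmenLindelof.quadrant_III hKd.diffContOnCl (hB _) (fun x _ => hre x)
        (fun x _ => him x) hr hi
  have hbdd : Bornology.IsBounded (Set.range K) :=
    (Metric.isBounded_closedBall (x := (0 : ℂ)) (r := C)).subset (by
      rintro _ ⟨z, rfl⟩
      simpa using hbound z)
  obtain ⟨γ, hγ⟩ := hKd.exists_const_forall_eq_of_bounded hbdd
  refine ⟨γ, fun z => ?_⟩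
  rw [← hγ (z / (1 + I))]
  simp only [hK, div_mul_cancel₀ _ hne]

namespace IsFermatSolution

variable {f : ℂ → ℂ}

lemma exists_ray_bounds (hf : IsFermatSolution f) : ∃ e, (e = I ∨ e = 2 * I) ∧
    ∀ d : ℂ, d.im = 1 → ‖d‖ ≤ 2 → ∃ C, ∀ t : ℝ, 0 ≤ t →
      ‖deriv f (t * d)‖ ≤ C * Real.exp t ∧
      ‖f (t * d) - e * deriv f (t * d)‖ ≤ C * Real.exp (-t) := by
  obtain ⟨e, he, Y, hY, h⟩ := hf.exists_equilibrium
  have he' := hf.equilibrium_eq_I_or_two_I he hY (fun z hz => (h z hz).1)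
  refine ⟨e, he', fun d hd hd2 => ?_⟩
  obtain ⟨C, hC⟩ : ∃ C, ∀ t : ℝ, Y ≤ t → ‖deriv f (t * d)‖ ≤ C * Real.exp t ∧
      ‖f (t * d) - e * deriv f (t * d)‖ ≤ C * Real.exp (-t) := by
    rcases he' with rfl | rfl
    · exact hf.bounds_of_near_I hY h hd hd2
    · exact ⟨1, fun t ht => by simpa using hf.bounds_of_near_two_I hY h hd hd2 ht⟩
  have hray : Continuous fun t : ℝ => (t : ℂ) * d := by fun_prop
  have hc := hf.differentiable.continuous.comp hray
  have hc' := hf.differentiable_deriv.continuous.comp hray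
  obtain ⟨C₁, h₁⟩ := exists_bound_Ici_zero hc' Real.continuous_exp Real.exp_pos
    (fun t ht => (hC t ht).1)
  obtain ⟨C₂, h₂⟩ := exists_bound_Ici_zero (hc.sub (hc'.const_mul e))
    (φ := fun t => Real.exp (-t)) (by fun_prop) (fun t => Real.exp_pos _)
    (fun t ht => (hC t ht).2)
  refine ⟨max C₁ C₂, fun t ht => ⟨(h₁ t ht).trans ?_, (h₂ t ht).trans ?_⟩⟩
  · exact mul_le_mul_of_nonneg_right (le_max_left _ _) (Real.exp_pos _).le
  · exact mul_le_mul_of_nonneg_right (le_max_right _ _) (Real.exp_pos _).le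

lemma exists_sub_mul_deriv_eq (hf : IsFermatSolution f) : ∃ e, (e = I ∨ e = 2 * I) ∧
    ∃ γ, ∀ z, f z - e * deriv f z = γ * exp (I * z) := by
  obtain ⟨e, he, hup⟩ := hf.exists_ray_bounds
  obtain ⟨e', he', hdown⟩ := hf.comp_neg.exists_ray_bounds
  refine ⟨e, he, ?_⟩
  have hnorm : ∀ e, (e = I ∨ e = 2 * I) → ‖e‖ ≤ 2 := by
    rintro e (rfl | rfl) <;> simp
  have hray : ∀ d : ℂ, d.im = 1 → ‖d‖ ≤ 2 → ∃ C, ∀ t : ℝ,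
      ‖(f (t * d) - e * deriv f (t * d)) * exp (-(I * (t * d)))‖ ≤ C := by
    intro d hd hd2
    obtain ⟨C₁, h₁⟩ := hup d hd hd2
    obtain ⟨C₂, h₂⟩ := hdown d hd hd2
    refine ⟨max C₁ (5 * C₂), fun t => ?_⟩
    have hexp : ‖exp (-(I * (t * d)))‖ = Real.exp t := by
      rw [norm_exp]; congr 1; simp [hd]
    rw [norm_mul, hexp]
    rcases le_total 0 t with ht | ht
    · refine le_trans ?_ (le_max_left _ _)
      calc _ ≤ C₁ * Real.exp (-t) * Real.exp t :=
            mul_le_mul_of_nonneg_right (h₁ t ht).2 (Real.exp_pos _).le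
        _ = C₁ := by rw [mul_assoc, ← Real.exp_add]; simp
    · refine le_trans ?_ (le_max_right _ _)
      obtain ⟨h3, h4⟩ := h₂ (-t) (by linarith)
      rw [deriv_comp_neg] at h3 h4
      simp only [ofReal_neg, neg_mul, neg_neg, norm_neg] at h3 h4
      have hC₂ : 0 ≤ C₂ := nonneg_of_mul_nonneg_left ((norm_nonneg _).trans h3) (Real.exp_pos _)
      have h5 : Real.exp t ≤ Real.exp (-t) := Real.exp_le_exp.2 (by linarith)
      have h6 : ‖f (t * d) - e * deriv f (t * d)‖ ≤ 5 * C₂ * Real.exp (-t) := by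
        have e1 : f (t * d) - e * deriv f (t * d) = (f (t * d) - e' * -deriv f (t * d)) -
            (e + e') * deriv f (t * d) := by ring
        rw [e1]
        refine (norm_sub_le _ _).trans ?_
        rw [norm_mul]
        have h7 : ‖e + e'‖ ≤ 4 := (norm_add_le _ _).trans (by linarith [hnorm e he, hnorm e' he'])
        have h8 : ‖e + e'‖ * ‖deriv f (t * d)‖ ≤ 4 * (C₂ * Real.exp (-t)) := by gcongr
        have h9 := mul_le_mul_of_nonneg_left h5 hC₂
        linarith
      calc _ ≤ 5 * C₂ * Real.exp (-t) * Real.exp t :=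
            mul_le_mul_of_nonneg_right h6 (Real.exp_pos _).le
        _ = 5 * C₂ := by rw [mul_assoc, ← Real.exp_add]; simp
  have hd₁ : ‖1 + I‖ ≤ 2 := (norm_add_le _ _).trans (by norm_num)
  have hd₂ : ‖-1 + I‖ ≤ 2 := (norm_add_le _ _).trans (by norm_num)
  obtain ⟨C₁, h₁⟩ := hray (1 + I) (by simp) hd₁
  obtain ⟨C₂, h₂⟩ := hray (-1 + I) (by simp) hd₂
  obtain ⟨γ, hγ⟩ := exists_const_of_bounded_on_diagonals
    (k := fun z => (f z - e * deriv f z) * exp (-(I * z))) (A := 3 * (‖f 0‖ + 2)) (B := 3)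
    (C := max C₁ C₂)
    ((hf.differentiable.sub (hf.differentiable_deriv.const_mul e)).mul
      (by fun_prop)) (fun z => by
        have h3 : ‖exp (-(I * z))‖ ≤ Real.exp ‖z‖ := by
          refine (norm_exp_le_exp_norm _).trans ?_
          simp
        have h4 : ‖f z - e * deriv f z‖ ≤ 3 * (‖f 0‖ + 2) * Real.exp (2 * ‖z‖) := by
          refine (norm_sub_le _ _).trans ?_
          rw [norm_mul]
          have h5 : ‖e‖ * ‖deriv f z‖ ≤ 2 * ((‖f 0‖ + 2) * Real.exp (2 * ‖z‖)) :=
            mul_le_mul (hnorm e he) (hf.norm_deriv_le_exp z) (norm_nonneg _) two_pos.le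
          linarith [hf.norm_le_exp z, Real.exp_pos (2 * ‖z‖)]
        have e3 : Real.exp (3 * ‖z‖) = Real.exp (2 * ‖z‖) * Real.exp ‖z‖ := by
          rw [← Real.exp_add]; ring_nf
        rw [norm_mul, e3, ← mul_assoc]
        gcongr)
    (fun t => (h₁ t).trans (le_max_left _ _)) (fun t => (h₂ t).trans (le_max_right _ _))
  refine ⟨γ, fun z => ?_⟩
  rw [← hγ z, mul_assoc, ← exp_add, neg_add_cancel, exp_zero, mul_one]

lemma exists_eq_add_exp (hf : IsFermatSolution f) :
    ∃ p q : ℂ, ∀ z, f z = p * exp (I * z) + q * exp (-(I * z)) := by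
  obtain ⟨e, he, γ, hγ⟩ := hf.exists_sub_mul_deriv_eq
  obtain ⟨e', he', δ, hδ⟩ := hf.comp_neg.exists_sub_mul_deriv_eq
  have hne : e + e' ≠ 0 := by
    rcases he with rfl | rfl <;> rcases he' with rfl | rfl <;>
      exact fun h => by have := congrArg im h; norm_num at this
  refine ⟨e' * γ / (e + e'), e * δ / (e + e'), fun z => ?_⟩
  have h1 := hγ z
  have h2 := hδ (-z)
  rw [deriv_comp_neg, neg_neg, mul_neg I] at h2
  field_simp
  linear_combination e' * h1 + e * h2

lemma eq_cos_or_sin (hf : IsFermatSolution f) :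
    (∃ c : ℂ, c ^ 4 = 1 ∧ ∀ z, f z = c * cos z) ∨
      (∃ c : ℂ, c ^ 4 = -1 ∧ ∀ z, f z = c * sin z) := by
  obtain ⟨p, q, h⟩ := hf.exists_eq_add_exp
  have hd : ∀ z, deriv f z = I * (p * exp (I * z) - q * exp (-(I * z))) := by
    intro z
    have h1 : HasDerivAt (fun z => I * z) I z := by simpa using (hasDerivAt_id z).const_mul I
    have h2 := (h1.cexp.const_mul p).add (h1.neg.cexp.const_mul q)
    have h3 : f = fun z => p * exp (I * z) + q * exp (-(I * z)) := funext h
    rw [h3]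
    refine h2.deriv.trans ?_
    simp only [Pi.neg_apply]
    ring
  have key : ∀ u w : ℂ, (u + w) ^ 4 - (I * (u - w)) ^ 4 = 8 * u * w * (u ^ 2 + w ^ 2) := by
    intro u w
    rw [mul_pow, I_pow_four]; ring
  have h0 := hf.eq 0
  rw [h, hd, key] at h0
  have h1 := hf.eq (Real.pi / 4)
  have hI : exp (I * (Real.pi / 4)) ^ 2 = I := by
    rw [← exp_nat_mul]
    refine Eq.trans ?_ exp_pi_div_two_mul_I
    congr 1; push_cast; ring
  have hI' : exp (-(I * (Real.pi / 4))) ^ 2 = -I := by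
    rw [exp_neg, inv_pow, hI, inv_I]
  have hmul : exp (I * (Real.pi / 4)) * exp (-(I * (Real.pi / 4))) = 1 := by
    rw [← exp_add, add_neg_cancel, exp_zero]
  have hcos : cos (2 * (Real.pi / 4 : ℂ)) = 0 := by
    rw [← cos_pi_div_two]; congr 1; ring
  rw [h, hd, key, hcos, mul_pow, mul_pow, hI, hI'] at h1
  simp only [mul_zero, neg_zero, exp_zero, mul_one, cos_zero] at h0
  have hpq : p * q ≠ 0 := fun hpq => by
    have : (1 : ℂ) = 0 := by rw [← h0]; linear_combination (8 * (p ^ 2 + q ^ 2)) * hpq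
    exact one_ne_zero this
  have h2 : p * q * (p ^ 2 - q ^ 2) = 0 := by
    have h3 : 8 * (p * q) * (p ^ 2 - q ^ 2) * I = 0 := by
      linear_combination h1 - 8 * p * q * (p ^ 2 * I - q ^ 2 * I) * hmul
    have : (8 : ℂ) * I ≠ 0 := by simp
    have h4 : 8 * I * (p * q * (p ^ 2 - q ^ 2)) = 0 := by linear_combination h3
    exact (mul_eq_zero.1 h4).resolve_left this
  have h3 : (q - p) * (q + p) = 0 := by
    linear_combination -(mul_eq_zero.1 h2).resolve_left hpq
  rcases mul_eq_zero.1 h3 with h4 | h4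
  · obtain rfl : q = p := sub_eq_zero.1 h4
    refine Or.inl ⟨2 * q, by linear_combination h0, fun z => ?_⟩
    rw [h, Complex.cos, mul_comm I z, ← neg_mul]; ring
  · obtain rfl : q = -p := eq_neg_of_add_eq_zero_left h4
    refine Or.inr ⟨2 * I * p, ?_, fun z => ?_⟩
    · rw [mul_pow, mul_pow, I_pow_four]; linear_combination -h0
    · rw [h, Complex.sin, mul_comm I z, ← neg_mul]
      linear_combination p * (exp (z * I) - exp (-z * I)) * I_sq

end IsFermatSolution

lemma isFermatSolution_const_mul_cos {c : ℂ} (hc : c ^ 4 = 1) :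
    IsFermatSolution (fun z => c * cos z) where
  differentiable := differentiable_cos.const_mul c
  eq z := by
    rw [((hasDerivAt_cos z).const_mul c).deriv, cos_two_mul]
    linear_combination (cos z ^ 4 - sin z ^ 4) * hc +
      (cos z ^ 2 - sin z ^ 2 - 1) * sin_sq_add_cos_sq z

lemma isFermatSolution_const_mul_sin {c : ℂ} (hc : c ^ 4 = -1) :
    IsFermatSolution (fun z => c * sin z) where
  differentiable := differentiable_sin.const_mul c
  eq z := by
    rw [((hasDerivAt_sin z).const_mul c).deriv, cos_two_mul]
    linear_combination (sin z ^ 4 - cos z ^ 4) * hc +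
      (cos z ^ 2 - sin z ^ 2 - 1) * sin_sq_add_cos_sq z

theorem stmt_9 (f : ℂ → ℂ) (hf : Differentiable ℂ f) :
    (∀ z : ℂ, f z ^ 4 - (deriv f z) ^ 4
        = (1 / 2) * Complex.exp (2 * Complex.I * z)
          + (1 / 2) * Complex.exp (-(2 * Complex.I) * z)) ↔
    ((∃ c : ℂ, c ^ 4 = 1 ∧ ∀ z : ℂ, f z = c * Complex.cos z) ∨
     (∃ c : ℂ, c ^ 4 = -1 ∧ ∀ z : ℂ, f z = c * Complex.sin z)) := by
  have hcos : ∀ z : ℂ, (1 / 2) * Complex.exp (2 * Complex.I * z)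
      + (1 / 2) * Complex.exp (-(2 * Complex.I) * z) = cos (2 * z) := by
    intro z
    rw [Complex.cos]
    ring_nf
  simp only [hcos]
  refine ⟨fun h => IsFermatSolution.eq_cos_or_sin ⟨hf, h⟩, ?_⟩
  rintro (⟨c, hc, h⟩ | ⟨c, hc, h⟩) <;> obtain rfl := funext h
  · exact (isFermatSolution_const_mul_cos hc).eq
  · exact (isFermatSolution_const_mul_sin hc).eq
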